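/- Let X be a finite abstract simplicial complex of dimension d on n vertices with a complete skeleton, fix α ∈ ℝ, and let ρ_α = ‖(α·I − Δ+)|_{Z_{d-1}}‖. Then for any pairwise disjoint sets of vertices A_0, …, A_d one has | |F(A_0,…,A_d)| − α·|A_0|⋯|A_d| / n | ≤ ρ_α · √(|A_0|·(1 − (Σ_{i=0}^{d-1}|A_i|)/n) · |A_d|·(1 − (Σ_{i=1}^{d}|A_i|)/n)) · |A_1|·|A_2|⋯|A_{d-1}|. -/

import Mathlib

open Finset

/-- A finite abstract simplicial complex on the vertex type `V`: a collection of finite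
subsets of `V` (the cells), closed under taking subsets and containing the empty cell. -/
structure SComplex (V : Type) [Fintype V] [DecidableEq V] : Type where
  cells : Finset (Finset V)
  empty_mem : ∅ ∈ cells
  down_closed : ∀ s ∈ cells, ∀ t ⊆ s, t ∈ cells

namespace SComplex

variable {V : Type} [Fintype V] [DecidableEq V]

/-- The cells of `X` with exactly `m` vertices, i.e. the `(m-1)`-dimensional cells `X^{m-1}`. -/
def cellsCard (X : SComplex V) (m : ℕ) : Finset (Finset V) :=
  X.cells.filter fun s => s.card = m

/-- `X` is `D`-dimensional: every cell has at most `D+1` vertices and some cell has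
exactly `D+1` vertices. -/
def Dim (X : SComplex V) (D : ℕ) : Prop :=
  (∀ s ∈ X.cells, s.card ≤ D + 1) ∧ ∃ s ∈ X.cells, s.card = D + 1

/-- `X` (of dimension `D`) has a complete skeleton: every subset of `V` with at most `D`
elements is a cell. -/
def CompleteSkeleton (X : SComplex V) (D : ℕ) : Prop :=
  ∀ s : Finset V, s.card ≤ D → s ∈ X.cells

/-- The set of vertices of an ordered tuple. -/
def tset {m : ℕ} (σ : Fin m → V) : Finset V := Finset.image σ Finset.univ

/-- An ordered tuple of vertices is an oriented cell when it is injective and its vertex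
set is a cell of `X`. -/
def IsCell (X : SComplex V) {m : ℕ} (σ : Fin m → V) : Prop :=
  Function.Injective σ ∧ tset σ ∈ X.cells

instance (X : SComplex V) {m : ℕ} (σ : Fin m → V) : Decidable (X.IsCell σ) := by
  unfold IsCell; infer_instance

/-- `X.nbr v σ` : the vertex `v` does not belong to `σ` and together with `σ` spans a
cell of `X`. -/
def nbr (X : SComplex V) {m : ℕ} (v : V) (σ : Fin m → V) : Prop :=
  v ∉ tset σ ∧ insert v (tset σ) ∈ X.cells

instance (X : SComplex V) {m : ℕ} (v : V) (σ : Fin m → V) : Decidable (X.nbr v σ) := by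
  unfold nbr; infer_instance

/-- `f` is an `(m-1)`-form on `X`: a function on ordered tuples of `m` vertices which is
skew-symmetric with respect to permutations of the tuple, and is supported on the
oriented `(m-1)`-cells of `X`. -/
def IsForm (X : SComplex V) (m : ℕ) (f : (Fin m → V) → ℝ) : Prop :=
  (∀ (σ : Fin m → V) (π : Equiv.Perm (Fin m)),
      f (σ ∘ π) = ((Equiv.Perm.sign π : ℤ) : ℝ) * f σ) ∧
  ∀ σ : Fin m → V, ¬ X.IsCell σ → f σ = 0

/-- The space `Ω^{m-1}(X)` of `(m-1)`-forms, as a submodule of the functions on tuples. -/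
def formSub (X : SComplex V) (m : ℕ) : Submodule ℝ ((Fin m → V) → ℝ) where
  carrier := {f | X.IsForm m f}
  add_mem' := @fun f g hf hg => ⟨fun σ π => by
      simp only [Pi.add_apply, hf.1 σ π, hg.1 σ π]; ring,
    fun σ h => by simp only [Pi.add_apply, hf.2 σ h, hg.2 σ h, add_zero]⟩
  zero_mem' := ⟨fun σ π => by simp, fun σ h => rfl⟩
  smul_mem' := @fun c f hf => ⟨fun σ π => by
      simp only [Pi.smul_apply, smul_eq_mul, hf.1 σ π]; ring,
    fun σ h => by simp only [Pi.smul_apply, hf.2 σ h, smul_eq_mul, mul_zero]⟩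

/-- The inner product `⟨f,g⟩ = ∑_{σ ∈ X^{m-1}} f(σ) g(σ)` on `(m-1)`-forms, computed via
ordered tuples (each cell is counted `m!` times, once for each ordering of its vertices). -/
noncomputable def innerForm (m : ℕ) (f g : (Fin m → V) → ℝ) : ℝ :=
  ((m.factorial : ℝ))⁻¹ * ∑ σ : Fin m → V, f σ * g σ

/-- The boundary operator `∂ : Ω^m → Ω^{m-1}`, `(∂f)(σ) = ∑_{v ∼ σ} f(vσ)`. -/
def bdry (X : SComplex V) (m : ℕ) (f : (Fin (m+1) → V) → ℝ) : (Fin m → V) → ℝ :=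
  fun σ => ∑ v : V, if X.nbr v σ then f (Fin.cons v σ) else 0

/-- The coboundary operator `∂* : Ω^{m-1} → Ω^m`, `(∂*f)(σ) = ∑ i (-1)^i f(σ ∖ σᵢ)`,
supported on the oriented `m`-cells of `X`. -/
def cobdry (X : SComplex V) (m : ℕ) (f : (Fin m → V) → ℝ) : (Fin (m+1) → V) → ℝ :=
  fun σ => if X.IsCell σ then ∑ i : Fin (m+1), (-1 : ℝ) ^ (i : ℕ) * f (σ ∘ i.succAbove) else 0

/-- The upper Laplacian `Δ⁺ = ∂ ∘ ∂*` on `(m-1)`-forms. -/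
def upLap (X : SComplex V) (m : ℕ) (f : (Fin m → V) → ℝ) : (Fin m → V) → ℝ :=
  X.bdry m (X.cobdry m f)

/-- The lower Laplacian `Δ⁻ = ∂* ∘ ∂` on `m`-forms. -/
def lowLap (X : SComplex V) (m : ℕ) (f : (Fin (m+1) → V) → ℝ) : (Fin (m+1) → V) → ℝ :=
  X.cobdry m (X.bdry m f)

/-- The boundary operator as a linear map. -/
def bdryL (X : SComplex V) (m : ℕ) : ((Fin (m+1) → V) → ℝ) →ₗ[ℝ] ((Fin m → V) → ℝ) where
  toFun := X.bdry m
  map_add' f g := by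
    funext σ
    show (∑ v : V, if X.nbr v σ then (f + g) (Fin.cons v σ) else 0) =
      (∑ v : V, if X.nbr v σ then f (Fin.cons v σ) else 0) +
      (∑ v : V, if X.nbr v σ then g (Fin.cons v σ) else 0)
    rw [← Finset.sum_add_distrib]
    exact Finset.sum_congr rfl fun v _ => by by_cases h : X.nbr v σ <;> simp [h]
  map_smul' c f := by
    funext σ
    show (∑ v : V, if X.nbr v σ then (c • f) (Fin.cons v σ) else 0) =
      c * (∑ v : V, if X.nbr v σ then f (Fin.cons v σ) else 0)
    rw [Finset.mul_sum]
    exact Finset.sum_congr rfl fun v _ => by by_cases h : X.nbr v σ <;> simp [h]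

/-- The coboundary operator as a linear map. -/
def cobdryL (X : SComplex V) (m : ℕ) : ((Fin m → V) → ℝ) →ₗ[ℝ] ((Fin (m+1) → V) → ℝ) where
  toFun := X.cobdry m
  map_add' f g := by
    funext σ
    show X.cobdry m (f + g) σ = X.cobdry m f σ + X.cobdry m g σ
    unfold cobdry
    by_cases h : X.IsCell σ
    · simp only [h, if_true, ← Finset.sum_add_distrib]
      exact Finset.sum_congr rfl fun i _ => by simp [Pi.add_apply]; ring
    · simp [h]
  map_smul' c f := by
    funext σ
    show X.cobdry m (c • f) σ = c * X.cobdry m f σ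
    unfold cobdry
    by_cases h : X.IsCell σ
    · simp only [h, if_true, Finset.mul_sum]
      exact Finset.sum_congr rfl fun i _ => by simp [Pi.smul_apply]; ring
    · simp [h]

/-- The degree of a cell `s`: the number of cells with one more vertex containing `s`. -/
def degCell (X : SComplex V) (s : Finset V) : ℕ :=
  (X.cells.filter fun t => s ⊆ t ∧ t.card = s.card + 1).card

/-- The maximal degree of an `(m-1)`-cell of `X`. -/
def maxDeg (X : SComplex V) (m : ℕ) : ℕ :=
  (X.cellsCard m).sup fun s => X.degCell s

/-- The spectrum of the upper Laplacian of a `(d+1)`-dimensional complex restricted to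
the cycle space `Z = ker ∂` inside the space of forms on `d+1` vertices. -/
def specUpLapZ (X : SComplex V) (d : ℕ) : Set ℝ :=
  {μ | ∃ f : (Fin (d+1) → V) → ℝ,
    X.IsForm (d+1) f ∧ X.bdry d f = 0 ∧ f ≠ 0 ∧ X.upLap (d+1) f = μ • f}

/-- The spectral gap `λ(X) = min Spec (Δ⁺|_Z)` of a `(d+1)`-dimensional complex. -/
noncomputable def spectralGap (X : SComplex V) (d : ℕ) : ℝ :=
  sInf (X.specUpLapZ d)

/-- `F(A 0, …, A (m-1))`: the set of cells with `m` vertices having exactly one vertex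
in each `A i`. -/
def Fcells (X : SComplex V) {m : ℕ} (A : Fin m → Finset V) : Finset (Finset V) :=
  X.cells.filter fun s => s.card = m ∧ ∀ i, (s ∩ A i).card = 1

/-- The Cheeger constant of a `(d+1)`-dimensional complex: the minimum over all
partitions of the vertex set into `d+2` nonempty parts of `n·|F(A₀,…)|/∏|Aᵢ|`. -/
noncomputable def cheeger (X : SComplex V) (d : ℕ) : ℝ :=
  sInf { r : ℝ | ∃ A : Fin (d+2) → Finset V,
    (∀ i, (A i).Nonempty) ∧ (∀ i j, i ≠ j → Disjoint (A i) (A j)) ∧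
    Finset.univ.biUnion A = Finset.univ ∧
    r = (Fintype.card V : ℝ) * ((X.Fcells A).card : ℝ) / ∏ i, ((A i).card : ℝ) }

/-- The `m`-th reduced Betti number `β_m = dim H_m` of `X` over `ℝ`:
`dim (Ω^m ∩ ker ∂_m) - dim (∂_{m+1} Ω^{m+1})`. -/
noncomputable def betti (X : SComplex V) (m : ℕ) : ℕ :=
  Module.finrank ℝ ↥(X.formSub (m+1) ⊓ LinearMap.ker (X.bdryL m)) -
  Module.finrank ℝ ↥(Submodule.map (X.bdryL (m+1)) (X.formSub (m+2)))

/-- The vertices of the link of `τ`. -/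
def linkVerts (X : SComplex V) (τ : Finset V) : Finset V :=
  Finset.univ.filter fun v => v ∉ τ ∧ insert v τ ∈ X.cells

/-- The neighbours of `v` in the link graph of `τ`. -/
def linkNbrs (X : SComplex V) (τ : Finset V) (v : V) : Finset V :=
  Finset.univ.filter fun w => w ≠ v ∧ w ∉ τ ∧ v ∉ τ ∧ insert v (insert w τ) ∈ X.cells

/-- The graph Laplacian of the link of `τ`. -/
def linkLap (X : SComplex V) (τ : Finset V) (g : V → ℝ) : V → ℝ :=
  fun v => ((X.linkNbrs τ v).card : ℝ) * g v - ∑ w ∈ X.linkNbrs τ v, g w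

/-- The graph spectral gap of the link of `τ`: the minimal eigenvalue of its graph
Laplacian on functions on its vertices summing to zero. -/
noncomputable def linkGap (X : SComplex V) (τ : Finset V) : ℝ :=
  sInf {μ : ℝ | ∃ g : V → ℝ, (∀ v, v ∉ X.linkVerts τ → g v = 0) ∧
    (∑ v ∈ X.linkVerts τ, g v = 0) ∧ g ≠ 0 ∧
    ∀ v ∈ X.linkVerts τ, X.linkLap τ g v = μ * g v}

/-- The graph Cheeger constant of the link of `τ`: the minimum over partitions
`B ⊔ C` of its vertex set of `|W|·|E(B,C)|/(|B|·|C|)`. -/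
noncomputable def linkCheeger (X : SComplex V) (τ : Finset V) : ℝ :=
  sInf { r : ℝ | ∃ B C : Finset V, B.Nonempty ∧ C.Nonempty ∧ Disjoint B C ∧
    B ∪ C = X.linkVerts τ ∧
    r = ((X.linkVerts τ).card : ℝ) *
        (((B ×ˢ C).filter fun p => insert p.1 (insert p.2 τ) ∈ X.cells).card : ℝ) /
        ((B.card : ℝ) * (C.card : ℝ)) }

/-- `deg_τ(s)`: the number of neighbours `s'` of the cell `s` which contain `τ` (two
distinct cells with the same number of vertices are neighbours when their union is a
cell of `X` with one more vertex). -/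
def degTau (X : SComplex V) (τ s : Finset V) : ℕ :=
  (X.cells.filter fun s' => s'.card = s.card ∧ s' ≠ s ∧ τ ⊆ s' ∧
    (s ∪ s').card = s.card + 1 ∧ s ∪ s' ∈ X.cells).card

/-- The local upper Laplacian `Δ⁺_τ` associated to a cell `τ` with `d` vertices of a
`(d+1)`-dimensional complex, acting on forms on `d+1` vertices:
`(Δ⁺_τ f)(σ) = deg_τ(σ) f(σ) - ∑_{σ' ∼ σ, τ ⊆ σ'} f(σ')` when `τ ⊆ σ`, and `0` else. -/
def localUpLap (X : SComplex V) (d : ℕ) (τ : Finset V) (f : (Fin (d+1) → V) → ℝ) :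
    (Fin (d+1) → V) → ℝ :=
  fun σ => if τ ⊆ tset σ then
      (X.degTau τ (tset σ) : ℝ) * f σ -
        ∑ v : V, if X.nbr v σ then
          ∑ i : Fin (d+1), if σ i ∉ τ then
            (-1 : ℝ) ^ (i : ℕ) * f (Fin.cons v σ ∘ Fin.succAbove i.succ) else 0
        else 0
    else 0

/-- The complement complex `X̄` of a `D`-dimensional complex `X` with complete skeleton:
it has the same cells of dimension `< D`, and its `D`-dimensional cells are exactly the
vertex sets of size `D+1` which are not cells of `X`. -/
def complComplex (X : SComplex V) (D : ℕ) (hX : X.CompleteSkeleton D) : SComplex V where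
  cells := (X.cells.filter fun s => s.card ≤ D) ∪
    ((Finset.univ : Finset V).powersetCard (D+1)).filter fun s => s ∉ X.cells
  empty_mem := Finset.mem_union_left _ (Finset.mem_filter.mpr ⟨X.empty_mem, by simp⟩)
  down_closed := by
    intro s hs t ht
    rcases Finset.mem_union.mp hs with h | h
    · rw [Finset.mem_filter] at h
      exact Finset.mem_union_left _ (Finset.mem_filter.mpr
        ⟨X.down_closed s h.1 t ht, le_trans (Finset.card_le_card ht) h.2⟩)
    · rw [Finset.mem_filter, Finset.mem_powersetCard] at h
      by_cases hts : t = s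
      · subst hts
        exact Finset.mem_union_right _ (Finset.mem_filter.mpr
          ⟨Finset.mem_powersetCard.mpr h.1, h.2⟩)
      · have hlt : t.card < s.card := Finset.card_lt_card (ht.ssubset_of_ne hts)
        have hsD : s.card = D + 1 := h.1.2
        have htD : t.card ≤ D := by omega
        exact Finset.mem_union_left _ (Finset.mem_filter.mpr ⟨hX t htD, htD⟩)

/-- The simplicial complex on `V` with complete `(d+1)`-dimensional skeleton whose
top-dimensional cells (with `d+2` vertices) are the members of `T`: the Linial–Meshulam
complex determined by the sample `T`. -/
def lmComplex (V : Type) [Fintype V] [DecidableEq V] (d : ℕ) (T : Finset (Finset V)) :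
    SComplex V where
  cells := (Finset.univ.powerset.filter fun s : Finset V => s.card ≤ d + 1) ∪
    T.filter fun s => s.card = d + 2
  empty_mem := Finset.mem_union_left _ (by simp)
  down_closed := by
    intro s hs t ht
    rcases Finset.mem_union.mp hs with h | h
    · rw [Finset.mem_filter] at h
      exact Finset.mem_union_left _ (Finset.mem_filter.mpr
        ⟨Finset.mem_powerset.mpr (Finset.subset_univ t), le_trans (Finset.card_le_card ht) h.2⟩)
    · rw [Finset.mem_filter] at h
      by_cases hts : t = s
      · subst hts; exact Finset.mem_union_right _ (Finset.mem_filter.mpr h)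
      · have hlt : t.card < s.card := Finset.card_lt_card (ht.ssubset_of_ne hts)
        have hsd : s.card = d + 2 := h.2
        have htd : t.card ≤ d + 1 := by omega
        exact Finset.mem_union_left _ (Finset.mem_filter.mpr
          ⟨Finset.mem_powerset.mpr (Finset.subset_univ t), htd⟩)

open Classical in
/-- The probability, under the Linial–Meshulam measure `X(d+1, n, p)` (each possible
top-dimensional cell on `d+2` vertices is included independently with probability `p`),
of an event `E` depending on the set of top-dimensional cells. -/
noncomputable def lmProb (V : Type) [Fintype V] [DecidableEq V] (d : ℕ) (p : ℝ)
    (E : Finset (Finset V) → Prop) : ℝ :=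
  ∑ T ∈ ((Finset.univ : Finset V).powersetCard (d+2)).powerset,
    if E T then
      p ^ T.card * (1 - p) ^ (((Finset.univ : Finset V).powersetCard (d+2)).card - T.card)
    else 0

end SComplex

namespace SComplex

section Tuples

variable {V : Type} {m : ℕ}

/-- Skew-symmetry of a function on ordered tuples. -/
def IsSkew (f : (Fin m → V) → ℝ) : Prop :=
  ∀ (σ : Fin m → V) (π : Equiv.Perm (Fin m)),
    f (σ ∘ π) = ((Equiv.Perm.sign π : ℤ) : ℝ) * f σ

/-- The alternating sum of a function over the facets of a tuple. -/
def facetSum (f : (Fin m → V) → ℝ) (σ : Fin (m + 1) → V) : ℝ :=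
  ∑ i : Fin (m + 1), (-1 : ℝ) ^ (i : ℕ) * f (σ ∘ i.succAbove)

lemma IsSkew.eq_zero_of_not_injective {f : (Fin m → V) → ℝ} (hf : IsSkew f) {σ : Fin m → V}
    (hσ : ¬ Function.Injective σ) : f σ = 0 := by
  simp only [Function.Injective, not_forall] at hσ
  obtain ⟨i, j, hij, hne⟩ := hσ
  have h := hf σ (Equiv.swap i j)
  have hcomp : σ ∘ Equiv.swap i j = σ := by
    funext k
    simp only [Function.comp_apply, Equiv.swap_apply_def]
    split_ifs with h1 h2
    · rw [h1, hij]
    · rw [h2, hij]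
    · rfl
  rw [hcomp, Equiv.Perm.sign_swap hne] at h
  push_cast at h
  linarith

lemma comp_perm_comp_succAbove (π : Equiv.Perm (Fin (m + 1))) (i : Fin (m + 1)) :
    ∃ κ : Equiv.Perm (Fin m), π ∘ i.succAbove = (π i).succAbove ∘ κ ∧
      (-1 : ℝ) ^ (i : ℕ) * ((Equiv.Perm.sign κ : ℤ) : ℝ) =
        ((Equiv.Perm.sign π : ℤ) : ℝ) * (-1 : ℝ) ^ ((π i : Fin (m + 1)) : ℕ) := by
  set τ : Equiv.Perm (Fin (m + 1)) := (π i).cycleRange * π * i.cycleRange.symm with hτ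
  obtain ⟨⟨p, κ⟩, hκ⟩ := Equiv.Perm.decomposeFin.symm.surjective τ
  have h0 : τ 0 = 0 := by simp [hτ, Fin.cycleRange_symm_zero]
  have hp : p = 0 := by
    rw [← hκ, Equiv.Perm.decomposeFin_symm_apply_zero] at h0
    exact h0
  subst hp
  refine ⟨κ, ?_, ?_⟩
  · funext j
    have h1 : τ j.succ = (κ j).succ := by
      rw [← hκ, Equiv.Perm.decomposeFin_symm_apply_succ]; simp
    have h2 : (π i).cycleRange (π (i.succAbove j)) = (κ j).succ := by
      rw [← h1, hτ]; simp
    simp only [Function.comp_apply]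
    rw [← Fin.cycleRange_symm_succ (π i) (κ j), ← h2, Equiv.symm_apply_apply]
  · have hs : Equiv.Perm.sign τ = Equiv.Perm.sign κ := by
      rw [← hκ, Equiv.Perm.decomposeFin.symm_sign]; simp
    have hs' : Equiv.Perm.sign κ =
        (-1) ^ ((π i : Fin (m + 1)) : ℕ) * Equiv.Perm.sign π * (-1) ^ (i : ℕ) := by
      rw [← hs, hτ, Equiv.Perm.sign_mul, Equiv.Perm.sign_mul, Equiv.Perm.sign_symm,
        Fin.sign_cycleRange, Fin.sign_cycleRange]
    rw [hs']
    push_cast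
    have h1 : ((-1 : ℝ) ^ (i : ℕ)) * (-1) ^ (i : ℕ) = 1 := by rw [← mul_pow]; simp
    linear_combination ((-1 : ℝ) ^ ((π i : Fin (m + 1)) : ℕ) *
      ((Equiv.Perm.sign π : ℤ) : ℝ)) * h1

lemma IsSkew.facetSum {f : (Fin m → V) → ℝ} (hf : IsSkew f) : IsSkew (facetSum f) := by
  intro σ π
  unfold SComplex.facetSum
  rw [Finset.mul_sum, ← Equiv.sum_comp π (fun i : Fin (m + 1) =>
    ((Equiv.Perm.sign π : ℤ) : ℝ) * ((-1 : ℝ) ^ (i : ℕ) * f (σ ∘ i.succAbove)))]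
  refine Finset.sum_congr rfl fun i _ => ?_
  obtain ⟨κ, hκ, hs⟩ := comp_perm_comp_succAbove π i
  rw [Function.comp_assoc, hκ, ← Function.comp_assoc, hf, ← mul_assoc, hs, mul_assoc]

lemma IsSkew.apply_comp_cycleRange_symm {g : (Fin (m + 1) → V) → ℝ} (hg : IsSkew g)
    (σ : Fin (m + 1) → V) (i : Fin (m + 1)) :
    g (σ ∘ i.cycleRange.symm) = (-1 : ℝ) ^ (i : ℕ) * g σ := by
  rw [hg, Equiv.Perm.sign_symm, Fin.sign_cycleRange]
  push_cast
  rfl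

lemma insertNth_comp_cycleRange_symm (i : Fin (m + 1)) (v : V) (τ : Fin m → V) :
    (Fin.insertNth i v τ : Fin (m + 1) → V) ∘ i.cycleRange.symm = Fin.cons v τ := by
  funext j
  refine Fin.cases ?_ (fun j => ?_) j
  · simp [Fin.cycleRange_symm_zero]
  · simp

lemma IsSkew.apply_insertNth {g : (Fin (m + 1) → V) → ℝ} (hg : IsSkew g)
    (i : Fin (m + 1)) (v : V) (τ : Fin m → V) :
    (-1 : ℝ) ^ (i : ℕ) * g (Fin.insertNth i v τ) = g (Fin.cons v τ) := by
  rw [← hg.apply_comp_cycleRange_symm, insertNth_comp_cycleRange_symm]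

lemma cons_comp_perm (v : V) (σ : Fin m → V) (π : Equiv.Perm (Fin m)) :
    (Fin.cons v (σ ∘ π) : Fin (m + 1) → V) =
      (Fin.cons v σ : Fin (m + 1) → V) ∘ Equiv.Perm.decomposeFin.symm (0, π) := by
  funext j
  refine Fin.cases ?_ (fun j => ?_) j <;> simp

lemma facetSum_cons (f : (Fin (m + 1) → V) → ℝ) (v : V) (τ : Fin (m + 1) → V) :
    facetSum f (Fin.cons v τ) =
      f τ - ∑ i : Fin (m + 1), (-1 : ℝ) ^ (i : ℕ) * f (Fin.cons v (τ ∘ i.succAbove)) := by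
  unfold facetSum
  rw [Fin.sum_univ_succ, sub_eq_add_neg, ← Finset.sum_neg_distrib]
  congr 1
  · simp only [Fin.val_zero, pow_zero, one_mul]
    congr 1
  · refine Finset.sum_congr rfl fun i _ => ?_
    have : (Fin.cons v τ : Fin (m + 2) → V) ∘ i.succ.succAbove =
        Fin.cons v (τ ∘ i.succAbove) := by
      funext j
      refine Fin.cases ?_ (fun j => ?_) j
      · simp
      · simp [Fin.succ_succAbove_succ]
    rw [this, Fin.val_succ, pow_succ]
    ring

lemma sum_tuple_insertNth [Fintype V] (i : Fin (m + 1)) (F : (Fin (m + 1) → V) → ℝ) :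
    ∑ σ, F σ = ∑ τ : Fin m → V, ∑ v : V, F (Fin.insertNth i v τ) := by
  rw [← (Fin.insertNthEquiv (fun _ : Fin (m + 1) => V) i).sum_comp, Fintype.sum_prod_type,
    Finset.sum_comm]
  rfl

lemma sum_facetSum_cons [Fintype V] (f : (Fin (m + 1) → V) → ℝ) (τ : Fin (m + 1) → V) :
    ∑ v : V, facetSum f (Fin.cons v τ) =
      Fintype.card V * f τ - facetSum (fun ρ => ∑ v : V, f (Fin.cons v ρ)) τ := by
  simp_rw [facetSum_cons]
  rw [Finset.sum_sub_distrib, Finset.sum_comm]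
  simp [facetSum, Finset.mul_sum]

end Tuples

section Operators

variable {V : Type} [DecidableEq V] {m : ℕ}

lemma tset_comp_perm (σ : Fin m → V) (π : Equiv.Perm (Fin m)) : tset (σ ∘ π) = tset σ := by
  ext v
  simp only [tset, Finset.mem_image, Finset.mem_univ, true_and, Function.comp_apply]
  exact ⟨fun ⟨i, h⟩ => ⟨π i, h⟩, fun ⟨i, h⟩ => ⟨π.symm i, by simpa using h⟩⟩

lemma tset_cons (v : V) (σ : Fin m → V) :
    tset (Fin.cons v σ : Fin (m + 1) → V) = insert v (tset σ) := by
  ext w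
  simp only [tset, Finset.mem_image, Finset.mem_univ, true_and, Finset.mem_insert,
    Fin.exists_fin_succ, Fin.cons_zero, Fin.cons_succ]
  exact or_congr eq_comm Iff.rfl

variable [Fintype V]

lemma isCell_comp_perm (X : SComplex V) (σ : Fin m → V) (π : Equiv.Perm (Fin m)) :
    X.IsCell (σ ∘ π) ↔ X.IsCell σ := by
  unfold IsCell
  rw [tset_comp_perm, Function.Injective.of_comp_iff' σ π.bijective]

lemma isCell_cons_iff (X : SComplex V) (v : V) (σ : Fin m → V) :
    X.IsCell (Fin.cons v σ : Fin (m + 1) → V) ↔ Function.Injective σ ∧ X.nbr v σ := by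
  unfold IsCell nbr
  rw [tset_cons, Fin.cons_injective_iff]
  have : v ∉ Set.range σ ↔ v ∉ tset σ := by simp [tset]
  rw [this]
  tauto

lemma IsCell.of_cons {X : SComplex V} {v : V} {σ : Fin m → V}
    (h : X.IsCell (Fin.cons v σ : Fin (m + 1) → V)) : X.IsCell σ :=
  ⟨((isCell_cons_iff X v σ).1 h).1,
    X.down_closed _ h.2 _ (by rw [tset_cons]; exact Finset.subset_insert _ _)⟩

lemma IsForm.skew {X : SComplex V} {f : (Fin m → V) → ℝ} (hf : X.IsForm m f) : IsSkew f :=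
  hf.1

lemma IsSkew.isForm_cobdry {X : SComplex V} {f : (Fin m → V) → ℝ} (hf : IsSkew f) :
    X.IsForm (m + 1) (X.cobdry m f) := by
  refine ⟨fun σ π => ?_, fun σ h => if_neg h⟩
  have h := hf.facetSum σ π
  unfold SComplex.cobdry
  by_cases hc : X.IsCell σ
  · rw [if_pos hc, if_pos ((isCell_comp_perm X σ π).2 hc)]
    exact h
  · rw [if_neg hc, if_neg (mt (isCell_comp_perm X σ π).1 hc), mul_zero]

lemma IsForm.bdry_apply {X : SComplex V} {g : (Fin (m + 1) → V) → ℝ} (hg : X.IsForm (m + 1) g)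
    (σ : Fin m → V) : X.bdry m g σ = ∑ v : V, g (Fin.cons v σ) := by
  refine Finset.sum_congr rfl fun v _ => ?_
  split_ifs with h
  · rfl
  · exact (hg.2 _ fun hc => h ((isCell_cons_iff X v σ).1 hc).2).symm

lemma IsForm.bdry {X : SComplex V} {g : (Fin (m + 1) → V) → ℝ} (hg : X.IsForm (m + 1) g) :
    X.IsForm m (X.bdry m g) := by
  refine ⟨fun σ π => ?_, fun σ h => ?_⟩
  · rw [hg.bdry_apply, hg.bdry_apply, Finset.mul_sum]
    refine Finset.sum_congr rfl fun v _ => ?_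
    rw [cons_comp_perm, hg.1, Equiv.Perm.decomposeFin.symm_sign]
    simp
  · rw [hg.bdry_apply]
    exact Finset.sum_eq_zero fun v _ => hg.2 _ fun hc => h hc.of_cons

lemma IsForm.bdry_bdry {X : SComplex V} {g : (Fin (m + 2) → V) → ℝ} (hg : X.IsForm (m + 2) g) :
    X.bdry m (X.bdry (m + 1) g) = 0 := by
  funext σ
  rw [hg.bdry.bdry_apply]
  simp only [hg.bdry_apply, Pi.zero_apply]
  have hswap : ∀ v w : V, g (Fin.cons v (Fin.cons w σ : Fin (m + 1) → V)) =
      - g (Fin.cons w (Fin.cons v σ : Fin (m + 1) → V)) := by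
    intro v w
    have h := hg.1 (Fin.cons w (Fin.cons v σ : Fin (m + 1) → V)) (Equiv.swap 0 1)
    rw [Equiv.Perm.sign_swap (by simp)] at h
    have hc : (Fin.cons w (Fin.cons v σ : Fin (m + 1) → V) : Fin (m + 2) → V) ∘
        Equiv.swap (0 : Fin (m + 2)) 1 = Fin.cons v (Fin.cons w σ : Fin (m + 1) → V) := by
      funext j
      refine Fin.cases ?_ (fun j => Fin.cases ?_ (fun j => ?_) j) j
      · simp
      · simp
      · rw [Function.comp_apply, Equiv.swap_apply_of_ne_of_ne]
        · simp
        · exact Fin.succ_ne_zero _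
        · exact fun h => Fin.succ_ne_zero j (Fin.succ_injective _ h)
    rw [hc] at h
    simpa using h
  have h : ∑ v : V, ∑ w : V, g (Fin.cons w (Fin.cons v σ : Fin (m + 1) → V)) =
      - ∑ v : V, ∑ w : V, g (Fin.cons w (Fin.cons v σ : Fin (m + 1) → V)) := by
    conv_lhs => rw [Finset.sum_comm]
    rw [← Finset.sum_neg_distrib]
    refine Finset.sum_congr rfl fun v _ => ?_
    rw [← Finset.sum_neg_distrib]
    exact Finset.sum_congr rfl fun w _ => hswap v w
  linarith

/-- The coboundary operator is adjoint to the boundary operator. -/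
lemma IsForm.sum_cobdry_mul {X : SComplex V} {g : (Fin (m + 1) → V) → ℝ}
    (hg : X.IsForm (m + 1) g) (f : (Fin m → V) → ℝ) :
    ∑ σ, X.cobdry m f σ * g σ = (m + 1) * ∑ τ, f τ * X.bdry m g τ := by
  have h1 : ∀ σ, X.cobdry m f σ * g σ =
      ∑ i : Fin (m + 1), f (σ ∘ i.succAbove) * ((-1 : ℝ) ^ (i : ℕ) * g σ) := by
    intro σ
    unfold SComplex.cobdry
    split_ifs with h
    · rw [Finset.sum_mul]
      exact Finset.sum_congr rfl fun i _ => by ring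
    · simp [hg.2 σ h]
  simp_rw [h1]
  rw [Finset.sum_comm]
  have h2 : ∀ i : Fin (m + 1), ∑ σ, f (σ ∘ i.succAbove) * ((-1 : ℝ) ^ (i : ℕ) * g σ) =
      ∑ τ, f τ * X.bdry m g τ := by
    intro i
    rw [sum_tuple_insertNth i]
    refine Finset.sum_congr rfl fun τ _ => ?_
    rw [hg.bdry_apply, Finset.mul_sum]
    refine Finset.sum_congr rfl fun v _ => ?_
    rw [hg.skew.apply_insertNth]
    congr 2
    funext j
    simp
  simp [h2]

lemma IsSkew.isForm {X : SComplex V} {D : ℕ} (hX : X.CompleteSkeleton D) (hm : m ≤ D)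
    {f : (Fin m → V) → ℝ} (hf : IsSkew f) : X.IsForm m f := by
  refine ⟨hf, fun σ h => hf.eq_zero_of_not_injective fun hi => h ⟨hi, hX _ ?_⟩⟩
  exact (Finset.card_image_le.trans (by simp)).trans hm

lemma cobdry_eq_facetSum {X : SComplex V} {D : ℕ} (hX : X.CompleteSkeleton D) (hm : m + 1 ≤ D)
    {f : (Fin m → V) → ℝ} (hf : IsSkew f) : X.cobdry m f = facetSum f := by
  funext σ
  unfold SComplex.cobdry
  split_ifs with h
  · rfl
  · exact ((hf.facetSum.isForm hX hm).2 σ h).symm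

/-- With a complete skeleton, `∂ ∂* ∂ = n ∂` below the top dimension. -/
lemma IsForm.bdry_cobdry_bdry {X : SComplex V} (hX : X.CompleteSkeleton (m + 1))
    {f : (Fin (m + 1) → V) → ℝ} (hf : X.IsForm (m + 1) f) :
    X.bdry m (X.cobdry m (X.bdry m f)) = (Fintype.card V : ℝ) • X.bdry m f := by
  funext σ
  rw [hf.bdry.skew.isForm_cobdry.bdry_apply, cobdry_eq_facetSum hX le_rfl hf.bdry.skew]
  cases m with
  | zero =>
    simp only [facetSum, Pi.smul_apply, smul_eq_mul]
    simp
  | succ k =>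
    have h0 : (fun ρ : Fin k → V => ∑ v : V, X.bdry (k + 1) f (Fin.cons v ρ)) = 0 := by
      rw [← hf.bdry_bdry]
      funext ρ
      exact (hf.bdry.bdry_apply ρ).symm
    rw [sum_facetSum_cons, h0]
    simp [facetSum]

end Operators

end SComplex

/-- A symmetric operator on a finite-dimensional space whose eigenvalues are bounded by `ρ` in
absolute value has norm at most `ρ`. -/
lemma LinearMap.IsSymmetric.norm_apply_le {E : Type*} [NormedAddCommGroup E]
    [InnerProductSpace ℝ E] [FiniteDimensional ℝ E] {T : E →ₗ[ℝ] E} (hT : T.IsSymmetric)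
    {ρ : ℝ} (hρ0 : 0 ≤ ρ) (hρ : ∀ μ : ℝ, Module.End.HasEigenvalue T μ → |μ| ≤ ρ) (x : E) :
    ‖T x‖ ≤ ρ * ‖x‖ := by
  have hb := hT.eigenvectorBasis_apply_self_apply rfl x
  set b := hT.eigenvectorBasis rfl
  refine le_of_sq_le_sq ?_ (by positivity)
  rw [mul_pow, ← b.sum_sq_norm_inner_right, ← b.sum_sq_norm_inner_right x, Finset.mul_sum]
  refine Finset.sum_le_sum fun i _ => ?_
  have h := hb i
  rw [b.repr_apply_apply, b.repr_apply_apply] at h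
  rw [h, norm_mul, mul_pow]
  refine mul_le_mul_of_nonneg_right ?_ (by positivity)
  exact pow_le_pow_left₀ (norm_nonneg _) (hρ _ (hT.hasEigenvalue_eigenvalues rfl i)) 2

/-- Bound on the quadratic form of an operator preserving a subspace `Z`, symmetric on `Z`, with
the eigenvalues on `Z` bounded by `ρ`. -/
lemma abs_sum_mul_apply_le {ι : Type*} [Fintype ι] (Z : Submodule ℝ (ι → ℝ))
    (T : (ι → ℝ) →ₗ[ℝ] (ι → ℝ)) (hTZ : ∀ f ∈ Z, T f ∈ Z)
    (hT : ∀ f ∈ Z, ∀ g ∈ Z, ∑ i, T f i * g i = ∑ i, f i * T g i) {ρ : ℝ} (hρ0 : 0 ≤ ρ)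
    (hρ : ∀ μ : ℝ, ∀ f ∈ Z, f ≠ 0 → T f = μ • f → |μ| ≤ ρ) {f g : ι → ℝ}
    (hf : f ∈ Z) (hg : g ∈ Z) :
    |∑ i, f i * T g i| ≤ ρ * (Real.sqrt (∑ i, f i ^ 2) * Real.sqrt (∑ i, g i ^ 2)) := by
  let e := WithLp.linearEquiv 2 ℝ (ι → ℝ)
  let W : Submodule ℝ (EuclideanSpace ℝ ι) := Z.comap e.toLinearMap
  let S : W →ₗ[ℝ] W := (e.symm.toLinearMap ∘ₗ T ∘ₗ e.toLinearMap).restrict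
    (fun x hx => hTZ _ hx)
  have hinner : ∀ x y : W, inner ℝ x y = ∑ i, e x i * e y i := by
    intro x y
    rw [Submodule.coe_inner, PiLp.inner_apply]
    exact Finset.sum_congr rfl fun i _ => mul_comm _ _
  have hS : ∀ x : W, e (S x) = T (e x) := fun x => rfl
  have hsymm : S.IsSymmetric := by
    intro x y
    rw [hinner, hinner, hS, hS]
    exact hT _ x.2 _ y.2
  have hev : ∀ μ : ℝ, Module.End.HasEigenvalue S μ → |μ| ≤ ρ := by
    intro μ hμ
    obtain ⟨x, hx⟩ := hμ.exists_hasEigenvector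
    refine hρ μ (e x) x.2 (fun h => hx.2 ?_) ?_
    · exact Subtype.ext (e.map_eq_zero_iff.1 h)
    · rw [← hS, hx.apply_eq_smul]
      rfl
  have hnorm : ∀ x : W, ‖x‖ = Real.sqrt (∑ i, e x i ^ 2) := by
    intro x
    rw [Submodule.coe_norm, EuclideanSpace.norm_eq]
    simp only [Real.norm_eq_abs, sq_abs]
    rfl
  have key : ∀ x y : W, |∑ i, e x i * T (e y) i| ≤
      ρ * (Real.sqrt (∑ i, e x i ^ 2) * Real.sqrt (∑ i, e y i ^ 2)) := by
    intro x y
    rw [← hS, ← hinner, ← hnorm, ← hnorm]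
    calc |inner ℝ x (S y)| ≤ ‖x‖ * ‖S y‖ := abs_real_inner_le_norm _ _
      _ ≤ ‖x‖ * (ρ * ‖y‖) :=
        mul_le_mul_of_nonneg_left (hsymm.norm_apply_le hρ0 hev y) (norm_nonneg _)
      _ = ρ * (‖x‖ * ‖y‖) := by ring
  exact key ⟨e.symm f, hf⟩ ⟨e.symm g, hg⟩

namespace SComplex

section Determinants

variable {V : Type} {m : ℕ}

/-- The skew-symmetric function `σ ↦ det (φ j (σ i))`. -/
def detForm (φ : Fin m → V → ℝ) (σ : Fin m → V) : ℝ :=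
  (Matrix.of fun i j => φ j (σ i)).det

lemma isSkew_detForm (φ : Fin m → V → ℝ) : IsSkew (detForm φ) := fun σ π =>
  Matrix.det_permute π (Matrix.of fun i j => φ j (σ i))

lemma facetSum_detForm_eq_cons (φ : Fin m → V → ℝ) (σ : Fin (m + 1) → V) :
    facetSum (detForm φ) σ = detForm (Fin.cons 1 φ : Fin (m + 1) → V → ℝ) σ := by
  rw [detForm, Matrix.det_succ_column_zero]
  refine Finset.sum_congr rfl fun i _ => ?_
  simp [detForm, Matrix.submatrix]

lemma facetSum_detForm_eq_snoc (φ : Fin m → V → ℝ) (σ : Fin (m + 1) → V) :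
    facetSum (detForm φ) σ =
      (-1) ^ m * detForm (Fin.snoc φ 1 : Fin (m + 1) → V → ℝ) σ := by
  rw [detForm, Matrix.det_succ_column _ (Fin.last m), facetSum, Finset.mul_sum]
  refine Finset.sum_congr rfl fun i _ => ?_
  have h : (-1 : ℝ) ^ m * (-1) ^ m = 1 := by rw [← mul_pow]; simp
  simp only [detForm, Matrix.submatrix, Fin.succAbove_last, Matrix.of_apply, Fin.snoc_last,
    Fin.snoc_castSucc, Fin.val_last, Pi.one_apply, pow_add, Function.comp_apply, mul_one]
  generalize Matrix.det (n := Fin m) (R := ℝ) (Matrix.of _) = D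
  linear_combination -((-1) ^ (i : ℕ) * D) * h

variable [Fintype V]

lemma sum_detForm_cons (φ : Fin (m + 1) → V → ℝ) (τ : Fin m → V) :
    ∑ v : V, detForm φ (Fin.cons v τ) =
      ∑ j : Fin (m + 1), (-1) ^ (j : ℕ) * (∑ v : V, φ j v) * detForm (φ ∘ j.succAbove) τ := by
  have h : ∀ v : V, detForm φ (Fin.cons v τ) =
      ∑ j : Fin (m + 1), (-1) ^ (j : ℕ) * φ j v * detForm (φ ∘ j.succAbove) τ := by
    intro v
    rw [detForm, Matrix.det_succ_row_zero]
    refine Finset.sum_congr rfl fun j _ => ?_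
    simp [detForm, Matrix.submatrix]
  simp_rw [h]
  rw [Finset.sum_comm]
  simp only [Finset.mul_sum, Finset.sum_mul]

lemma IsSkew.sum_detForm_mul {g : (Fin m → V) → ℝ} (hg : IsSkew g) (φ : Fin m → V → ℝ) :
    ∑ σ, detForm φ σ * g σ = m.factorial * ∑ σ : Fin m → V, (∏ i, φ i (σ i)) * g σ := by
  simp only [detForm, Matrix.det_apply', Finset.sum_mul]
  rw [Finset.sum_comm]
  have h : ∀ π : Equiv.Perm (Fin m), ∑ σ : Fin m → V, ((Equiv.Perm.sign π : ℤ) : ℝ) *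
      (∏ i, (Matrix.of fun i j => φ j (σ i)) (π i) i) * g σ =
      ∑ σ : Fin m → V, (∏ i, φ i (σ i)) * g σ := by
    intro π
    rw [← (Equiv.arrowCongr π.symm (Equiv.refl V)).sum_comp
      (fun σ : Fin m → V => (∏ i, φ i (σ i)) * g σ)]
    refine Finset.sum_congr rfl fun σ _ => ?_
    have hc : Equiv.arrowCongr π.symm (Equiv.refl V) σ = σ ∘ π := by
      funext i
      simp [Equiv.arrowCongr]
    rw [hc, hg σ π]
    simp only [Matrix.of_apply, Function.comp_apply]
    ring
  simp_rw [h]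
  simp [Fintype.card_perm]

/-- Andréief's identity. -/
lemma sum_detForm_mul_detForm (φ ψ : Fin m → V → ℝ) :
    ∑ σ, detForm φ σ * detForm ψ σ =
      m.factorial * (Matrix.of fun i j => ∑ v : V, φ i v * ψ j v).det := by
  rw [(isSkew_detForm ψ).sum_detForm_mul]
  congr 1
  have h := (Matrix.detRowAlternating (n := Fin m) (R := ℝ)).toMultilinearMap.map_sum
    (fun (i : Fin m) (v : V) (j : Fin m) => φ i v * ψ j v)
  have h1 : (fun i : Fin m => ∑ v : V, fun j : Fin m => φ i v * ψ j v) =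
      Matrix.of fun i j => ∑ v : V, φ i v * ψ j v := by
    funext i j
    simp
  rw [h1] at h
  refine Eq.trans ?_ h.symm
  refine Finset.sum_congr rfl fun σ _ => ?_
  rw [detForm, ← Matrix.det_mul_column]
  rfl

end Determinants

section DisjointFamily

variable {V : Type} [Fintype V] [DecidableEq V] {m : ℕ}

/-- The real-valued indicator function of a finite set. -/
def indic (B : Finset V) (v : V) : ℝ := if v ∈ B then 1 else 0

lemma sum_indic (B : Finset V) : ∑ v : V, indic B v = B.card := by
  simp [indic]

lemma sum_indic_mul_indic (B C : Finset V) :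
    ∑ v : V, indic B v * indic C v = ((B ∩ C).card : ℝ) := by
  rw [← sum_indic]
  refine Finset.sum_congr rfl fun v _ => ?_
  by_cases h1 : v ∈ B <;> by_cases h2 : v ∈ C <;> simp [indic, h1, h2]

variable {ι : Type} {A : ι → Finset V}

lemma sum_detForm_indic_eq_zero (hA : ∀ i j, i ≠ j → Disjoint (A i) (A j))
    {p q : Fin m → ι} {i : Fin m} (hi : ∀ j, p i ≠ q j) :
    ∑ σ, detForm (fun k => indic (A (p k))) σ * detForm (fun k => indic (A (q k))) σ = 0 := by
  rw [sum_detForm_mul_detForm, Matrix.det_eq_zero_of_row_eq_zero i, mul_zero]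
  intro j
  rw [Matrix.of_apply, sum_indic_mul_indic,
    Finset.disjoint_iff_inter_eq_empty.1 (hA _ _ (hi j))]
  simp

lemma sum_detForm_indic_self (hA : ∀ i j, i ≠ j → Disjoint (A i) (A j))
    {p : Fin m → ι} (hp : Function.Injective p) :
    ∑ σ, detForm (fun k => indic (A (p k))) σ * detForm (fun k => indic (A (p k))) σ =
      m.factorial * ∏ k, ((A (p k)).card : ℝ) := by
  have h : (Matrix.of fun i j => ∑ v : V, indic (A (p i)) v * indic (A (p j)) v) =
      Matrix.diagonal fun k => ((A (p k)).card : ℝ) := by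
    ext i j
    rw [Matrix.of_apply, sum_indic_mul_indic]
    by_cases hij : i = j
    · subst hij
      simp
    · rw [Finset.disjoint_iff_inter_eq_empty.1 (hA _ _ (hp.ne hij)),
        Matrix.diagonal_apply_ne _ hij]
      simp
  rw [sum_detForm_mul_detForm, h, Matrix.det_diagonal]

lemma bdry_detForm_indic {X : SComplex V} {p : Fin (m + 1) → ι}
    (h : X.IsForm (m + 1) (detForm fun k => indic (A (p k)))) (τ : Fin m → V) :
    X.bdry m (detForm fun k => indic (A (p k))) τ =
      ∑ j : Fin (m + 1), (-1) ^ (j : ℕ) * ((A (p j)).card : ℝ) *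
        detForm (fun k => indic (A (p (j.succAbove k)))) τ := by
  rw [h.bdry_apply, sum_detForm_cons]
  simp only [sum_indic]
  rfl

lemma sum_bdry_mul_bdry {X : SComplex V} {p q : Fin (m + 1) → ι}
    (hp : X.IsForm (m + 1) (detForm fun k => indic (A (p k))))
    (hq : X.IsForm (m + 1) (detForm fun k => indic (A (q k)))) :
    ∑ τ, X.bdry m (detForm fun k => indic (A (p k))) τ *
        X.bdry m (detForm fun k => indic (A (q k))) τ =
      ∑ i : Fin (m + 1), ∑ j : Fin (m + 1), (-1) ^ (i : ℕ) * (-1) ^ (j : ℕ) *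
        ((A (p i)).card : ℝ) * ((A (q j)).card : ℝ) *
        ∑ τ, detForm (fun k => indic (A (p (i.succAbove k)))) τ *
          detForm (fun k => indic (A (q (j.succAbove k)))) τ := by
  simp_rw [bdry_detForm_indic hp, bdry_detForm_indic hq, Finset.sum_mul_sum, Finset.mul_sum]
  rw [Finset.sum_comm]
  refine Finset.sum_congr rfl fun i _ => ?_
  rw [Finset.sum_comm]
  refine Finset.sum_congr rfl fun j _ => Finset.sum_congr rfl fun τ _ => ?_
  ring

lemma sum_bdry_mul_self {X : SComplex V} (hA : ∀ i j, i ≠ j → Disjoint (A i) (A j))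
    {p : Fin (m + 1) → ι} (hp : Function.Injective p)
    (h : X.IsForm (m + 1) (detForm fun k => indic (A (p k)))) :
    ∑ τ, X.bdry m (detForm fun k => indic (A (p k))) τ *
        X.bdry m (detForm fun k => indic (A (p k))) τ =
      m.factorial * ((∑ k, ((A (p k)).card : ℝ)) * ∏ k, ((A (p k)).card : ℝ)) := by
  rw [sum_bdry_mul_bdry h h, Finset.sum_mul, Finset.mul_sum]
  refine Finset.sum_congr rfl fun i _ => ?_
  rw [Finset.sum_eq_single i]
  · rw [sum_detForm_indic_self hA (p := fun k => p (i.succAbove k))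
      (hp.comp Fin.succAbove_right_injective), Fin.prod_univ_succAbove _ i]
    have h1 : ((-1 : ℝ) ^ (i : ℕ)) * (-1) ^ (i : ℕ) = 1 := by rw [← mul_pow]; simp
    rw [h1]
    ring
  · intro j _ hij
    obtain ⟨k, hk⟩ := Fin.exists_succAbove_eq hij
    rw [sum_detForm_indic_eq_zero hA (p := fun k => p (i.succAbove k))
      (q := fun k => p (j.succAbove k)) (i := k), mul_zero]
    intro l hl
    have := hp hl
    rw [hk] at this
    exact Fin.succAbove_ne j l this.symm
  · simp

end DisjointFamily

section MixingLemma

variable {V : Type} [DecidableEq V] {d : ℕ} {A : Fin (d + 2) → Finset V}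

lemma prod_mul_detForm_cons (hA : ∀ i j, i ≠ j → Disjoint (A i) (A j)) (σ : Fin (d + 2) → V) :
    (∏ i : Fin (d + 1), indic (A i.castSucc) (σ i.castSucc)) *
      detForm (Fin.cons 1 fun k => indic (A k.succ) : Fin (d + 2) → V → ℝ) σ =
      if ∀ i, σ i ∈ A i then 1 else 0 := by
  by_cases h : ∀ i : Fin (d + 1), σ i.castSucc ∈ A i.castSucc
  · have hdet : detForm (Fin.cons 1 fun k => indic (A k.succ) : Fin (d + 2) → V → ℝ) σ =
        ∏ i : Fin (d + 1), indic (A i.succ) (σ i.succ) := by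
      rw [detForm, Matrix.det_of_isLowerTriangular, Fin.prod_univ_succ]
      · simp
      · intro i j hij
        replace hij : i < j := hij
        obtain ⟨i, rfl⟩ := Fin.exists_castSucc_eq.2 (hij.trans_le (Fin.le_last j)).ne
        obtain ⟨j, rfl⟩ := Fin.exists_succ_eq.2 (Fin.zero_le i.castSucc |>.trans_lt hij).ne'
        simp only [Matrix.of_apply, Fin.cons_succ, indic]
        rw [if_neg]
        exact Finset.disjoint_left.1 (hA _ _ hij.ne) (h i)
    rw [hdet, Finset.prod_eq_one fun i _ => by simp [indic, h i], one_mul]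
    split_ifs with hall
    · exact Finset.prod_eq_one fun i _ => by simp [indic, hall i.succ]
    · refine Finset.prod_eq_zero (Finset.mem_univ (Fin.last d)) ?_
      rw [indic, if_neg]
      intro hl
      exact hall fun i => Fin.lastCases hl h i
  · rw [if_neg fun hall => h fun i => hall _]
    simp only [not_forall] at h
    obtain ⟨i, hi⟩ := h
    rw [Finset.prod_eq_zero (Finset.mem_univ i) (by simp [indic, hi]), zero_mul]

variable [Fintype V]

lemma sum_bdry_castSucc_mul_bdry_succ {X : SComplex V}
    (hA : ∀ i j, i ≠ j → Disjoint (A i) (A j))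
    (h0 : X.IsForm (d + 1) (detForm fun k => indic (A k.castSucc)))
    (h1 : X.IsForm (d + 1) (detForm fun k => indic (A k.succ))) :
    ∑ τ, X.bdry d (detForm fun k => indic (A k.castSucc)) τ *
        X.bdry d (detForm fun k => indic (A k.succ)) τ =
      (-1) ^ d * d.factorial * ∏ i, ((A i).card : ℝ) := by
  rw [sum_bdry_mul_bdry h0 h1, Finset.sum_eq_single 0, Finset.sum_eq_single (Fin.last d)]
  · have hp : (fun k : Fin d => indic (A ((Fin.succAbove 0 k).castSucc))) =
        fun k : Fin d => indic (A k.succ.castSucc) := by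
      funext k
      simp
    have hq : (fun k : Fin d => indic (A (((Fin.last d).succAbove k).succ))) =
        fun k : Fin d => indic (A k.succ.castSucc) := by
      funext k
      simp
    rw [hp, hq, sum_detForm_indic_self hA (p := fun k : Fin d => k.succ.castSucc)
      ((Fin.castSucc_injective _).comp (Fin.succ_injective _)),
      Fin.prod_univ_castSucc (n := d + 1), Fin.prod_univ_succ (n := d)]
    simp only [Fin.val_zero, Fin.val_last, Fin.castSucc_zero, Fin.succ_last]
    ring
  · intro j _ hj
    obtain ⟨k, hk⟩ := Fin.exists_succAbove_eq hj.symm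
    simp_rw [mul_comm (detForm (fun k => indic (A (Fin.castSucc _))) _)]
    rw [sum_detForm_indic_eq_zero hA (p := fun k => (j.succAbove k).succ)
      (q := fun k : Fin d => (Fin.succAbove 0 k).castSucc) (i := k), mul_zero]
    intro l
    rw [hk, Fin.succ_last]
    exact (Fin.castSucc_lt_last _).ne'
  · simp
  · intro i _ hi
    refine Finset.sum_eq_zero fun j _ => ?_
    obtain ⟨k, hk⟩ := Fin.exists_succAbove_eq hi.symm
    rw [sum_detForm_indic_eq_zero hA (p := fun k => (i.succAbove k).castSucc)
      (q := fun k : Fin d => (j.succAbove k).succ) (i := k), mul_zero]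
    intro l
    rw [hk, Fin.castSucc_zero]
    exact (Fin.succ_ne_zero _).symm
  · simp

lemma card_Fcells_eq (X : SComplex V) {m : ℕ} {A : Fin m → Finset V}
    (hA : ∀ i j, i ≠ j → Disjoint (A i) (A j)) :
    (X.Fcells A).card =
      (Finset.univ.filter fun σ : Fin m → V => (∀ i, σ i ∈ A i) ∧ X.IsCell σ).card := by
  have hidx : ∀ {i j : Fin m} {v : V}, v ∈ A i → v ∈ A j → i = j := by
    intro i j v hi hj
    by_contra hne
    exact Finset.disjoint_left.1 (hA i j hne) hi hj
  symm
  refine Finset.card_bij (fun σ _ => tset σ) ?_ ?_ ?_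
  · intro σ hσ
    obtain ⟨hmem, hinj, hcell⟩ := (Finset.mem_filter.1 hσ).2
    refine Finset.mem_filter.2 ⟨hcell, ?_, fun i => Finset.card_eq_one.2 ⟨σ i, ?_⟩⟩
    · rw [tset, Finset.card_image_of_injective _ hinj, Finset.card_univ, Fintype.card_fin]
    · ext v
      simp only [tset, Finset.mem_inter, Finset.mem_image, Finset.mem_univ, true_and,
        Finset.mem_singleton]
      constructor
      · rintro ⟨⟨j, rfl⟩, hv⟩
        rw [hidx hv (hmem j)]
      · rintro rfl
        exact ⟨⟨i, rfl⟩, hmem i⟩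
  · intro σ hσ τ hτ h
    have hσ := (Finset.mem_filter.1 hσ).2.1
    have hτ := (Finset.mem_filter.1 hτ).2.1
    funext i
    have hi : σ i ∈ tset τ := h ▸ Finset.mem_image_of_mem σ (Finset.mem_univ i)
    obtain ⟨j, -, hj⟩ := Finset.mem_image.1 hi
    have : i = j := hidx (hσ i) (hj ▸ hτ j)
    rw [← hj, this]
  · intro s hs
    obtain ⟨hs, hcard, hone⟩ := Finset.mem_filter.1 hs
    have hne : ∀ i, ∃ v, v ∈ s ∩ A i := fun i =>
      Finset.card_pos.1 ((hone i).symm ▸ Nat.one_pos)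
    choose σ hσ using hne
    have hmem : ∀ i, σ i ∈ A i := fun i => (Finset.mem_inter.1 (hσ i)).2
    have hinj : Function.Injective σ := fun i j h => hidx (hmem i) (h ▸ hmem j)
    have ht : tset σ = s := by
      refine Finset.eq_of_subset_of_card_le ?_ ?_
      · intro v hv
        obtain ⟨i, -, rfl⟩ := Finset.mem_image.1 hv
        exact (Finset.mem_inter.1 (hσ i)).1
      · rw [tset, Finset.card_image_of_injective _ hinj, Finset.card_univ, Fintype.card_fin,
          hcard]
    exact ⟨σ, Finset.mem_filter.2 ⟨Finset.mem_univ _, hmem, hinj, ht.symm ▸ hs⟩, ht⟩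

lemma sum_cobdry_castSucc_mul_cobdry_succ (X : SComplex V)
    (hA : ∀ i j, i ≠ j → Disjoint (A i) (A j)) :
    ∑ σ, X.cobdry (d + 1) (detForm fun k => indic (A k.castSucc)) σ *
        X.cobdry (d + 1) (detForm fun k => indic (A k.succ)) σ =
      (-1) ^ (d + 1) * (d + 2).factorial * ((X.Fcells A).card : ℝ) := by
  have hskew : IsSkew (X.cobdry (d + 1) (detForm fun k => indic (A k.succ))) :=
    (isSkew_detForm _).isForm_cobdry.skew
  have h1 : ∀ σ, X.cobdry (d + 1) (detForm fun k => indic (A k.castSucc)) σ *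
        X.cobdry (d + 1) (detForm fun k => indic (A k.succ)) σ =
      (-1) ^ (d + 1) * (detForm (Fin.snoc (fun k => indic (A k.castSucc)) 1 :
        Fin (d + 2) → V → ℝ) σ * X.cobdry (d + 1) (detForm fun k => indic (A k.succ)) σ) := by
    intro σ
    by_cases hσ : X.IsCell σ
    · have : X.cobdry (d + 1) (detForm fun k => indic (A k.castSucc)) σ =
          facetSum (detForm fun k => indic (A k.castSucc)) σ := if_pos hσ
      rw [this, facetSum_detForm_eq_snoc]
      ring
    · have : X.cobdry (d + 1) (detForm fun k => indic (A k.succ)) σ = 0 := if_neg hσ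
      simp [this]
  simp_rw [h1]
  rw [← Finset.mul_sum, hskew.sum_detForm_mul, card_Fcells_eq X hA, Finset.card_filter,
    Nat.cast_sum, ← mul_assoc]
  congr 1
  refine Finset.sum_congr rfl fun σ _ => ?_
  rw [Fin.prod_univ_castSucc]
  simp only [Fin.snoc_castSucc, Fin.snoc_last, Pi.one_apply, mul_one]
  by_cases hσ : X.IsCell σ
  · have : X.cobdry (d + 1) (detForm fun k => indic (A k.succ)) σ =
        facetSum (detForm fun k => indic (A k.succ)) σ := if_pos hσ
    rw [this, facetSum_detForm_eq_cons, prod_mul_detForm_cons hA]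
    simp [hσ]
  · have : X.cobdry (d + 1) (detForm fun k => indic (A k.succ)) σ = 0 := if_neg hσ
    simp [this, hσ]

end MixingLemma

end SComplex

namespace SComplex

section Projection

variable {V : Type} [Fintype V] [DecidableEq V] {d : ℕ} {X : SComplex V}

lemma IsSkew.sum_upLap_mul {f : (Fin d → V) → ℝ} (hf : IsSkew f) (g : (Fin d → V) → ℝ) :
    (d + 1) * ∑ σ, X.upLap d f σ * g σ = ∑ σ, X.cobdry d f σ * X.cobdry d g σ := by
  simp_rw [mul_comm (X.cobdry d f _), mul_comm (X.upLap d f _)]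
  exact (hf.isForm_cobdry.sum_cobdry_mul g).symm

lemma sum_upLap_mul_comm {f g : (Fin d → V) → ℝ} (hf : IsSkew f) (hg : IsSkew g) :
    ∑ σ, X.upLap d f σ * g σ = ∑ σ, f σ * X.upLap d g σ := by
  have h1 := hf.sum_upLap_mul (X := X) g
  have h2 := hg.sum_upLap_mul (X := X) f
  simp_rw [mul_comm (X.cobdry d g _), ← h1, mul_comm (X.upLap d g _)] at h2
  exact (mul_left_cancel₀ (by positivity) h2).symm

/-- The space of cycles `Z = ker ∂` in the forms on `d + 1` vertices. -/
def cycles (X : SComplex V) (d : ℕ) : Submodule ℝ ((Fin (d + 1) → V) → ℝ) :=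
  X.formSub (d + 1) ⊓ LinearMap.ker (X.bdryL d)

lemma mem_cycles {f : (Fin (d + 1) → V) → ℝ} :
    f ∈ X.cycles d ↔ X.IsForm (d + 1) f ∧ X.bdry d f = 0 := Iff.rfl

lemma upLap_mem_cycles {f : (Fin (d + 1) → V) → ℝ} (hf : IsSkew f) :
    X.upLap (d + 1) f ∈ X.cycles d :=
  mem_cycles.2 ⟨hf.isForm_cobdry.bdry, hf.isForm_cobdry.bdry_bdry⟩

/-- For a complete skeleton, the orthogonal projection of forms onto the cycles. -/
noncomputable def cycleProj (X : SComplex V) (d : ℕ) (f : (Fin (d + 1) → V) → ℝ) :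
    (Fin (d + 1) → V) → ℝ :=
  f - (Fintype.card V : ℝ)⁻¹ • X.cobdry d (X.bdry d f)

lemma cycleProj_mem_cycles [Nonempty V] (hX : X.CompleteSkeleton (d + 1))
    {f : (Fin (d + 1) → V) → ℝ} (hf : X.IsForm (d + 1) f) : X.cycleProj d f ∈ X.cycles d := by
  refine ⟨Submodule.sub_mem _ hf (Submodule.smul_mem _ _ hf.bdry.skew.isForm_cobdry), ?_⟩
  rw [SetLike.mem_coe, LinearMap.mem_ker, cycleProj, map_sub, map_smul]
  have h : X.bdryL d (X.cobdry d (X.bdry d f)) = (Fintype.card V : ℝ) • X.bdry d f :=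
    hf.bdry_cobdry_bdry hX
  have hn : (Fintype.card V : ℝ) ≠ 0 := Nat.cast_ne_zero.2 Fintype.card_ne_zero
  rw [h, smul_smul, inv_mul_cancel₀ hn, one_smul]
  exact sub_self _

lemma sum_cycleProj_mul (f : (Fin (d + 1) → V) → ℝ) {g : (Fin (d + 1) → V) → ℝ}
    (hg : X.IsForm (d + 1) g) :
    ∑ σ, X.cycleProj d f σ * g σ = ∑ σ, f σ * g σ -
      (d + 1) / (Fintype.card V : ℝ) * ∑ τ, X.bdry d f τ * X.bdry d g τ := by
  simp only [cycleProj, Pi.sub_apply, Pi.smul_apply, smul_eq_mul, sub_mul, mul_assoc]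
  rw [Finset.sum_sub_distrib, ← Finset.mul_sum, hg.sum_cobdry_mul]
  ring

lemma sum_cycleProj_mul_of_mem_cycles (f : (Fin (d + 1) → V) → ℝ)
    {g : (Fin (d + 1) → V) → ℝ} (hg : g ∈ X.cycles d) :
    ∑ σ, X.cycleProj d f σ * g σ = ∑ σ, f σ * g σ := by
  rw [sum_cycleProj_mul f (mem_cycles.1 hg).1, (mem_cycles.1 hg).2]
  simp

lemma sum_cycleProj_mul_cycleProj [Nonempty V] (hX : X.CompleteSkeleton (d + 1))
    {f g : (Fin (d + 1) → V) → ℝ} (hf : X.IsForm (d + 1) f) (hg : X.IsForm (d + 1) g) :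
    ∑ σ, X.cycleProj d f σ * X.cycleProj d g σ = ∑ σ, f σ * g σ -
      (d + 1) / (Fintype.card V : ℝ) * ∑ τ, X.bdry d f τ * X.bdry d g τ := by
  rw [← sum_cycleProj_mul f hg]
  simp_rw [mul_comm (X.cycleProj d f _)]
  exact sum_cycleProj_mul_of_mem_cycles g (cycleProj_mem_cycles hX hf)

lemma sum_cycleProj_mul_upLap_cycleProj [Nonempty V] (hX : X.CompleteSkeleton (d + 1))
    {f g : (Fin (d + 1) → V) → ℝ} (hf : X.IsForm (d + 1) f) (hg : X.IsForm (d + 1) g) :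
    (d + 2) * ∑ σ, X.cycleProj d f σ * X.upLap (d + 1) (X.cycleProj d g) σ =
      ∑ σ, X.cobdry (d + 1) f σ * X.cobdry (d + 1) g σ := by
  have hg' := (mem_cycles.1 (cycleProj_mem_cycles hX hg)).1.skew
  have h := hf.skew.sum_upLap_mul (X := X) g
  rw [sum_cycleProj_mul_of_mem_cycles f (upLap_mem_cycles hg'),
    ← sum_upLap_mul_comm hf.skew hg', ← h]
  simp_rw [mul_comm (X.upLap (d + 1) f _)]
  rw [sum_cycleProj_mul_of_mem_cycles g (upLap_mem_cycles hf.skew)]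
  push_cast
  ring

/-- The bilinear form of `α - Δ⁺` on cycles is bounded by the largest absolute value of its
eigenvalues. -/
lemma abs_sum_mul_sub_upLap_le {α ρ : ℝ} (hρ0 : 0 ≤ ρ)
    (hρ : ∀ μ ∈ X.specUpLapZ d, |α - μ| ≤ ρ) {f g : (Fin (d + 1) → V) → ℝ}
    (hf : f ∈ X.cycles d) (hg : g ∈ X.cycles d) :
    |α * ∑ σ, f σ * g σ - ∑ σ, f σ * X.upLap (d + 1) g σ| ≤
      ρ * (Real.sqrt (∑ σ, f σ ^ 2) * Real.sqrt (∑ σ, g σ ^ 2)) := by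
  let T : ((Fin (d + 1) → V) → ℝ) →ₗ[ℝ] ((Fin (d + 1) → V) → ℝ) :=
    α • LinearMap.id - X.bdryL (d + 1) ∘ₗ X.cobdryL (d + 1)
  have hT : ∀ f, T f = α • f - X.upLap (d + 1) f := fun _ => rfl
  have h := abs_sum_mul_apply_le (X.cycles d) T
    (fun f hf => Submodule.sub_mem _ (Submodule.smul_mem _ _ hf)
      (upLap_mem_cycles (mem_cycles.1 hf).1.skew))
    (fun f hf g hg => by
      simp only [hT, Pi.sub_apply, Pi.smul_apply, smul_eq_mul, sub_mul, mul_sub]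
      rw [Finset.sum_sub_distrib, Finset.sum_sub_distrib,
        sum_upLap_mul_comm (mem_cycles.1 hf).1.skew (mem_cycles.1 hg).1.skew]
      congr 1
      exact Finset.sum_congr rfl fun σ _ => by ring)
    hρ0
    (fun μ f hf hf0 hμ => by
      have := hρ (α - μ) ⟨f, (mem_cycles.1 hf).1, (mem_cycles.1 hf).2, hf0, by
        rw [sub_smul, ← hμ, hT, sub_sub_cancel]⟩
      rwa [sub_sub_cancel] at this)
    hf hg
  refine le_of_eq_of_le (congrArg abs ?_) h
  simp only [hT, Pi.sub_apply, Pi.smul_apply, smul_eq_mul, mul_sub]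
  rw [Finset.sum_sub_distrib, Finset.mul_sum]
  congr 1
  exact Finset.sum_congr rfl fun σ _ => by ring

end Projection

end SComplex


open SComplex in
/-- The refined Mixing Lemma (remark at the end of Section 4.3): with `ρ_α` the maximal
absolute value of an eigenvalue of `α·I - Δ⁺` restricted to `Z`, for pairwise disjoint
vertex sets `A 0, …, A (d+1)` one has
`| |F(A₀,…)| − α·∏|Aᵢ|/n | ≤ ρ_α·√(|A₀|(1−∑_{i<d+1}|Aᵢ|/n)·|A_{d+1}|(1−∑_{i>0}|Aᵢ|/n))·∏_{0<i<d+1}|Aᵢ|`. -/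
theorem refined_mixing_lemma (V : Type) [Fintype V] [DecidableEq V] (d : ℕ)
    (X : SComplex V) (hdim : X.Dim (d + 1)) (hskel : X.CompleteSkeleton (d + 1))
    (α ρ : ℝ)
    (hρ : IsGreatest {r : ℝ | ∃ μ ∈ X.specUpLapZ d, r = |α - μ|} ρ)
    (A : Fin (d + 2) → Finset V) (hA : ∀ i j, i ≠ j → Disjoint (A i) (A j)) :
    |((X.Fcells A).card : ℝ) - α * (∏ i, ((A i).card : ℝ)) / (Fintype.card V : ℝ)| ≤
      ρ * Real.sqrt (((A 0).card : ℝ) *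
            (1 - (∑ i : Fin (d + 1), ((A i.castSucc).card : ℝ)) / (Fintype.card V : ℝ)) *
          (((A (Fin.last (d + 1))).card : ℝ) *
            (1 - (∑ i : Fin (d + 1), ((A i.succ).card : ℝ)) / (Fintype.card V : ℝ)))) *
        ∏ i : Fin d, ((A i.succ.castSucc).card : ℝ) := by
  have hV : Nonempty V := by
    obtain ⟨s, -, hs⟩ := hdim.2
    obtain ⟨v, -⟩ := Finset.card_pos.1 (by rw [hs]; exact Nat.succ_pos _)
    exact ⟨v⟩
  have hρ0 : 0 ≤ ρ := by
    obtain ⟨μ, -, rfl⟩ := hρ.1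
    exact abs_nonneg _
  set n : ℝ := (Fintype.card V : ℝ)
  set f : (Fin (d + 1) → V) → ℝ := detForm fun k => indic (A k.castSucc)
  set g : (Fin (d + 1) → V) → ℝ := detForm fun k => indic (A k.succ)
  have hf : X.IsForm (d + 1) f := (isSkew_detForm _).isForm hskel le_rfl
  have hg : X.IsForm (d + 1) g := (isSkew_detForm _).isForm hskel le_rfl
  set M : ℝ := ∏ i : Fin d, ((A i.succ.castSucc).card : ℝ)
  set a : ℝ := ((A 0).card : ℝ)
  set b : ℝ := ((A (Fin.last (d + 1))).card : ℝ)
  set s : ℝ := 1 - (∑ i : Fin (d + 1), ((A i.castSucc).card : ℝ)) / n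
  set t : ℝ := 1 - (∑ i : Fin (d + 1), ((A i.succ).card : ℝ)) / n
  have hfac : ((d + 1).factorial : ℝ) = (d + 1) * d.factorial := by
    rw [Nat.factorial_succ]; push_cast; ring
  have hprodf : ∏ i : Fin (d + 1), ((A i.castSucc).card : ℝ) = a * M := by
    rw [Fin.prod_univ_succ]; rfl
  have hprodg : ∏ i : Fin (d + 1), ((A i.succ).card : ℝ) = b * M := by
    rw [Fin.prod_univ_castSucc, mul_comm]; rfl
  have hprod : ∏ i, ((A i).card : ℝ) = a * b * M := by
    rw [Fin.prod_univ_castSucc, hprodf]; ring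
  have hff : ∑ σ, X.cycleProj d f σ ^ 2 = (d + 1).factorial * (a * s * M) := by
    simp_rw [pow_two]
    rw [sum_cycleProj_mul_cycleProj hskel hf hf,
      sum_detForm_indic_self hA (p := Fin.castSucc) (Fin.castSucc_injective _),
      sum_bdry_mul_self hA (p := Fin.castSucc) (Fin.castSucc_injective _) hf, hprodf, hfac]
    ring
  have hgg : ∑ σ, X.cycleProj d g σ ^ 2 = (d + 1).factorial * (b * t * M) := by
    simp_rw [pow_two]
    rw [sum_cycleProj_mul_cycleProj hskel hg hg,
      sum_detForm_indic_self hA (p := Fin.succ) (Fin.succ_injective _),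
      sum_bdry_mul_self hA (p := Fin.succ) (Fin.succ_injective _) hg, hprodg, hfac]
    ring
  have hfg : ∑ σ, X.cycleProj d f σ * X.cycleProj d g σ =
      (d + 1).factorial * (-1) ^ (d + 1) * ((∏ i, ((A i).card : ℝ)) / n) := by
    rw [sum_cycleProj_mul_cycleProj hskel hf hg,
      sum_detForm_indic_eq_zero hA (p := Fin.castSucc) (q := Fin.succ) (i := 0)
        (fun j => (Fin.succ_ne_zero j).symm),
      sum_bdry_castSucc_mul_bdry_succ hA hf hg, hfac]
    ring
  have hLap : ∑ σ, X.cycleProj d f σ * X.upLap (d + 1) (X.cycleProj d g) σ =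
      (d + 1).factorial * (-1) ^ (d + 1) * ((X.Fcells A).card : ℝ) := by
    have h := sum_cycleProj_mul_upLap_cycleProj hskel hf hg
    rw [sum_cobdry_castSucc_mul_cobdry_succ X hA, Nat.factorial_succ (d + 1)] at h
    refine mul_left_cancel₀ (show (d + 2 : ℝ) ≠ 0 by positivity) (h.trans ?_)
    push_cast
    ring
  have hbound := abs_sum_mul_sub_upLap_le (α := α) hρ0 (fun μ hμ => hρ.2 ⟨μ, hμ, rfl⟩)
    (cycleProj_mem_cycles hskel hf) (cycleProj_mem_cycles hskel hg)
  have hfacpos : (0 : ℝ) < (d + 1).factorial := by positivity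
  have hM : 0 ≤ M := Finset.prod_nonneg fun i _ => Nat.cast_nonneg _
  rw [hfg, hLap, hff, hgg, ← Real.sqrt_mul (hff ▸ Finset.sum_nonneg fun σ _ => sq_nonneg _),
    show ((d + 1).factorial : ℝ) * (a * s * M) * ((d + 1).factorial * (b * t * M)) =
      ((d + 1).factorial * M) ^ 2 * (a * s * (b * t)) by ring,
    Real.sqrt_mul (sq_nonneg _), Real.sqrt_sq (mul_nonneg hfacpos.le hM),
    show α * ((d + 1).factorial * (-1) ^ (d + 1) * ((∏ i, ((A i).card : ℝ)) / n)) -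
      (d + 1).factorial * (-1) ^ (d + 1) * ((X.Fcells A).card : ℝ) =
      (d + 1).factorial * ((-1) ^ (d + 1) *
        (α * (∏ i, ((A i).card : ℝ)) / n - (X.Fcells A).card)) by ring,
    abs_mul, abs_mul, abs_pow, abs_neg, abs_one, one_pow, one_mul, abs_of_pos hfacpos,
    abs_sub_comm] at hbound
  refine le_of_mul_le_mul_left (hbound.trans_eq ?_) hfacpos
  ring
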